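/- arXiv:math/0506227 — 5 statements merged into one kernel-verified Lean document; each statement's English description precedes it below -/
import Mathlib

section
/- Let μ > 0, 0 < p ≤ 1, and let F be the distribution function of a nonnegative random variable with mean 1/μ satisfying sup_{x≥0, y≥0} |F_y(x) − F(x)| < ε. Let B(x) = p·F(x) + (1−p)·(1 − e^{−μx}) be the distribution function of a nonnegative random variable χ. Then sup_{x≥0, y≥0} |B_y(x) − B(x)| < 5ε, where B_y(x) = Pr{χ ≤ x + y | χ > y}. -/
open MeasureTheory Real Set

/-- The conditional distribution function `G_y(x) = Pr{ξ ≤ x + y | ξ > y}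
= (G(x+y) - G(y)) / (1 - G(y))`, with the convention `0/0 = 0`
(which is automatic for real division in Lean). -/
noncomputable def condF (G : ℝ → ℝ) (y x : ℝ) : ℝ := (G (x + y) - G y) / (1 - G y)

section AlmostMultiplicative

variable {G : ℝ → ℝ} {μ s : ℝ}

/-- If a nonnegative function of total mass `1/μ` on `(0, ∞)` is almost multiplicative, then it is
close to its normalised tail integral. -/
lemma abs_sub_mul_integral_Ioi_le (hμ : 0 < μ) (hG : IntegrableOn G (Ioi 0))
    (hmass : ∫ y in Ioi 0, G y = 1 / μ)
    (hmul : ∀ x ≥ 0, ∀ y ≥ 0, |G (x + y) - G x * G y| ≤ s * G y) {x : ℝ} (hx : 0 ≤ x) :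
    |G x - μ * ∫ y in Ioi x, G y| ≤ s := by
  have hpre : (fun y => x + y) ⁻¹' Ioi x = Ioi (0 : ℝ) := by
    ext y; simp
  have hemb : MeasurableEmbedding (fun y : ℝ => x + y) := measurableEmbedding_addLeft x
  have hpres := measurePreserving_add_left (volume : Measure ℝ) x
  have hshift : ∫ y in Ioi 0, G (x + y) = ∫ y in Ioi x, G y := by
    rw [← hpres.setIntegral_preimage_emb hemb G (Ioi x), hpre]
  have hint : IntegrableOn (fun y => G (x + y)) (Ioi 0) := by
    have := (hpres.integrableOn_comp_preimage hemb (f := G) (s := Ioi x)).2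
      (hG.mono_set (Ioi_subset_Ioi hx))
    rwa [hpre] at this
  have hbound : |∫ y in Ioi 0, (G (x + y) - G x * G y)| ≤ ∫ y in Ioi 0, s * G y :=
    norm_integral_le_of_norm_le (f := fun y => G (x + y) - G x * G y) (hG.const_mul s)
      ((ae_restrict_mem measurableSet_Ioi).mono fun y hy => hmul x hx y (le_of_lt hy))
  rw [integral_sub hint (hG.const_mul _), integral_const_mul, integral_const_mul, hshift,
    hmass] at hbound
  calc |G x - μ * ∫ y in Ioi x, G y|
      = μ * |(∫ y in Ioi x, G y) - G x * (1 / μ)| := by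
        rw [← abs_of_pos hμ, ← abs_mul, abs_of_pos hμ, abs_sub_comm]
        congr 1
        field_simp
    _ ≤ μ * (s * (1 / μ)) := by gcongr
    _ = s := by field_simp

/-- The tail integral of a right-continuous function has a right derivative everywhere; if the
normalised tail integral is within `s` of the function, it is within `s` of the exponential. -/
lemma abs_mul_integral_Ioi_sub_exp_le (hμ : 0 < μ) (hG : IntegrableOn G (Ioi 0))
    (hmeas : Measurable G) (hcont : ∀ x, ContinuousWithinAt G (Ici x) x)
    (hmass : ∫ y in Ioi 0, G y = 1 / μ) (hs : 0 ≤ s)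
    (hclose : ∀ x ≥ 0, |G x - μ * ∫ y in Ioi x, G y| ≤ s) {x : ℝ} (hx : 0 ≤ x) :
    |μ * (∫ y in Ioi x, G y) - exp (-μ * x)| ≤ s := by
  have hii : ∀ t ≥ 0, IntervalIntegrable G volume 0 t := fun t ht =>
    (intervalIntegrable_iff_integrableOn_Ioc_of_le ht).2 (hG.mono_set Ioc_subset_Ioi_self)
  have htail : ∀ t ≥ 0, μ * (∫ y in Ioi t, G y) = 1 - μ * ∫ y in (0 : ℝ)..t, G y := by
    intro t ht
    rw [← intervalIntegral.integral_Ioi_sub_Ioi hG ht, hmass]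
    field_simp
    ring
  have hexp : ∀ t, HasDerivAt (fun t => exp (μ * t)) (exp (μ * t) * μ) t := fun t => by
    simpa using ((hasDerivAt_id t).const_mul μ).exp
  have hderiv : ∀ t ∈ Ico 0 x, HasDerivWithinAt
      (fun t => (1 - μ * ∫ y in (0 : ℝ)..t, G y) * exp (μ * t) - 1)
      (-(μ * G t) * exp (μ * t) + (1 - μ * ∫ y in (0 : ℝ)..t, G y) * (exp (μ * t) * μ))
      (Ici t) t := by
    intro t ht
    have hprim : HasDerivWithinAt (fun t => ∫ y in (0 : ℝ)..t, G y) (G t) (Ici t) t :=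
      intervalIntegral.integral_hasDerivWithinAt_right (hii t ht.1)
        hmeas.stronglyMeasurable.stronglyMeasurableAtFilter (t := Ioi t)
        ((hcont t).mono Ioi_subset_Ici_self)
    exact (((hprim.const_mul μ).const_sub 1).mul (hexp t).hasDerivWithinAt).sub_const 1
  have hcontH : ContinuousOn (fun t => (1 - μ * ∫ y in (0 : ℝ)..t, G y) * exp (μ * t) - 1)
      (Icc 0 x) := by
    have : ContinuousOn (fun t => ∫ y in (0 : ℝ)..t, G y) (Icc 0 x) := by
      have := intervalIntegral.continuousOn_primitive_interval (μ := volume) (f := G)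
        (a := 0) (b := x) (by
          rw [uIcc_of_le hx, integrableOn_Icc_iff_integrableOn_Ioc]
          exact hG.mono_set Ioc_subset_Ioi_self)
      rwa [uIcc_of_le hx] at this
    fun_prop
  have key := image_norm_le_of_norm_deriv_right_le_deriv_boundary hcontH hderiv
    (B := fun t => s * (exp (μ * t) - 1)) (B' := fun t => s * (exp (μ * t) * μ)) (by simp)
    (fun t => ((hexp t).sub_const 1).const_mul s)
    (fun t ht => by
      have h := hclose t ht.1
      rw [htail t ht.1] at h
      have hpos : 0 < exp (μ * t) * μ := by positivity
      rw [Real.norm_eq_abs, show -(μ * G t) * exp (μ * t)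
        + (1 - μ * ∫ y in (0 : ℝ)..t, G y) * (exp (μ * t) * μ)
        = -(G t - (1 - μ * ∫ y in (0 : ℝ)..t, G y)) * (exp (μ * t) * μ) by ring,
        abs_mul, abs_neg, abs_of_pos hpos]
      gcongr) (right_mem_Icc.2 hx)
  rw [Real.norm_eq_abs, ← htail x hx] at key
  have hmulexp : exp (μ * x) * exp (-μ * x) = 1 := by rw [← exp_add]; simp
  have hE : 0 < exp (-μ * x) := exp_pos _
  calc |μ * (∫ y in Ioi x, G y) - exp (-μ * x)|
      = |μ * (∫ y in Ioi x, G y) * exp (μ * x) - 1| * exp (-μ * x) := by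
        rw [← abs_of_pos hE, ← abs_mul, abs_of_pos hE, sub_mul, mul_assoc, hmulexp]
        simp
    _ ≤ s * (exp (μ * x) - 1) * exp (-μ * x) := by gcongr
    _ = s - s * exp (-μ * x) := by linear_combination s * hmulexp
    _ ≤ s := by linarith [mul_nonneg hs hE.le]

/-- An almost multiplicative tail function is close to the exponential of the same mean. -/
lemma abs_sub_exp_le_of_almost_multiplicative (hμ : 0 < μ) (hG : IntegrableOn G (Ioi 0))
    (hmeas : Measurable G) (hcont : ∀ x, ContinuousWithinAt G (Ici x) x)
    (hmass : ∫ y in Ioi 0, G y = 1 / μ) (hs : 0 ≤ s)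
    (hmul : ∀ x ≥ 0, ∀ y ≥ 0, |G (x + y) - G x * G y| ≤ s * G y) {x : ℝ} (hx : 0 ≤ x) :
    |G x - exp (-μ * x)| ≤ 2 * s := by
  have hclose : ∀ x ≥ 0, |G x - μ * ∫ y in Ioi x, G y| ≤ s := fun x hx =>
    abs_sub_mul_integral_Ioi_le hμ hG hmass hmul hx
  calc |G x - exp (-μ * x)| ≤ _ + _ := abs_sub_le _ (μ * ∫ y in Ioi x, G y) _
    _ ≤ s + s := add_le_add (hclose x hx)
      (abs_mul_integral_Ioi_sub_exp_le hμ hG hmeas hcont hmass hs hclose hx)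
    _ = 2 * s := by ring

end AlmostMultiplicative

lemma integral_Ioi_one_sub_cdf {ν : Measure ℝ} [IsProbabilityMeasure ν] (hν : ν (Iio 0) = 0)
    (hint : Integrable (fun x => x) ν) :
    ∫ t in Ioi 0, (1 - ProbabilityTheory.cdf ν t) = ∫ x, x ∂ν := by
  have hnn : 0 ≤ᵐ[ν] fun x => x := by
    have : {x : ℝ | ¬ (0 : ℝ → ℝ) x ≤ x} = Iio 0 := by ext x; simp
    rw [Filter.EventuallyLE, ae_iff, this, hν]
  rw [hint.integral_eq_integral_meas_lt hnn]
  refine integral_congr_ae (Filter.Eventually.of_forall fun t => ?_)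
  simp only [ProbabilityTheory.cdf_eq_real]
  rw [← probReal_compl_eq_one_sub measurableSet_Iic, compl_Iic]
  rfl

lemma condF_mem_Icc {G : ℝ → ℝ} (hG : Monotone G) (hG1 : ∀ x, G x ≤ 1) {x y : ℝ} (hx : 0 ≤ x) :
    condF G y x ∈ Icc (0 : ℝ) 1 := by
  have h1 : 0 ≤ 1 - G y := sub_nonneg.2 (hG1 y)
  refine ⟨div_nonneg (sub_nonneg.2 (hG (by linarith))) h1, div_le_one_of_le₀ ?_ h1⟩
  linarith [hG1 (x + y)]

lemma tail_add_sub_mul_abs_le {G : ℝ → ℝ} (hG : Monotone G) (hG1 : ∀ x, G x ≤ 1) {s x y : ℝ}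
    (hx : 0 ≤ x) (h : |condF G y x - G x| ≤ s) :
    |(1 - G (x + y)) - (1 - G x) * (1 - G y)| ≤ s * (1 - G y) := by
  rcases (hG1 y).eq_or_lt with hy | hy
  · have : G (x + y) = 1 := le_antisymm (hG1 _) (hy ▸ hG (by linarith))
    simp [this, hy]
  · have hpos : 0 < 1 - G y := sub_pos.2 hy
    have heq : (1 - G (x + y)) - (1 - G x) * (1 - G y) = -(condF G y x - G x) * (1 - G y) := by
      rw [condF]
      field_simp
      ring
    rw [heq, abs_mul, abs_neg, abs_of_pos hpos]
    gcongr

/-- The relative size of the correlation term in the tail of a mixture. -/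
lemma mul_mul_abs_sub_le_mixture {p a b : ℝ} (hp0 : 0 ≤ p) (hp1 : p ≤ 1) (ha : 0 ≤ a)
    (hb : 0 ≤ b) : p * (1 - p) * |a - b| ≤ p * a + (1 - p) * b := by
  have hq : 0 ≤ 1 - p := sub_nonneg.2 hp1
  have hpa := mul_nonneg hp0 ha
  have hqb := mul_nonneg hq hb
  have h1 := mul_nonneg hp0 hpa
  have h2 := mul_nonneg hq hqb
  have h3 := mul_nonneg hp0 hqb
  have h4 := mul_nonneg hq hpa
  rcases abs_cases (a - b) with ⟨h, _⟩ | ⟨h, _⟩ <;> rw [h] <;> nlinarith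

/-- The distance between residual and original law of a mixture with an exponential law. -/
lemma abs_condF_mixture_sub_le {F B : ℝ → ℝ} {μ p s x y : ℝ} (hp0 : 0 < p) (hp1 : p < 1)
    (hF1 : ∀ x, F x ≤ 1) (hB : ∀ x, B x = p * F x + (1 - p) * (1 - exp (-μ * x)))
    (hs : 0 ≤ s) (hmul : |(1 - F (x + y)) - (1 - F x) * (1 - F y)| ≤ s * (1 - F y))
    (hexp : |(1 - F x) - exp (-μ * x)| ≤ 2 * s) :
    |condF B y x - B x| ≤ 3 * s := by
  have hq : 0 < 1 - p := sub_pos.2 hp1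
  have hFy : 0 ≤ 1 - F y := sub_nonneg.2 (hF1 y)
  have hEy : 0 < exp (-μ * y) := exp_pos _
  have hBy : 1 - B y = p * (1 - F y) + (1 - p) * exp (-μ * y) := by rw [hB]; ring
  have hpos : 0 < 1 - B y := by rw [hBy]; positivity
  have hadd : exp (-μ * (x + y)) = exp (-μ * x) * exp (-μ * y) := by rw [← exp_add]; ring_nf
  have heq : (condF B y x - B x) * (1 - B y)
      = -(p * ((1 - F (x + y)) - (1 - F x) * (1 - F y)) + p * (1 - p)
        * ((1 - F y) - exp (-μ * y)) * ((1 - F x) - exp (-μ * x))) := by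
    rw [condF, sub_mul, div_mul_cancel₀ _ hpos.ne', hB (x + y), hB x, hB y, hadd]
    ring
  refine le_of_mul_le_mul_right ?_ hpos
  have hcorr := mul_mul_abs_sub_le_mixture hp0.le hp1.le hFy hEy.le
  have hqE := mul_nonneg hs (mul_nonneg hq.le hEy.le)
  calc |condF B y x - B x| * (1 - B y) = |(condF B y x - B x) * (1 - B y)| := by
        rw [abs_mul, abs_of_pos hpos]
    _ ≤ |p * ((1 - F (x + y)) - (1 - F x) * (1 - F y))| + |p * (1 - p)
        * ((1 - F y) - exp (-μ * y)) * ((1 - F x) - exp (-μ * x))| := by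
        rw [heq, abs_neg]; exact abs_add_le _ _
    _ = p * |(1 - F (x + y)) - (1 - F x) * (1 - F y)| + p * (1 - p)
        * |(1 - F y) - exp (-μ * y)| * |(1 - F x) - exp (-μ * x)| := by
        rw [abs_mul, abs_mul, abs_mul, abs_of_pos hp0, abs_of_pos (mul_pos hp0 hq)]
    _ ≤ p * (s * (1 - F y)) + (p * (1 - F y) + (1 - p) * exp (-μ * y)) * (2 * s) := by
        gcongr
    _ ≤ 3 * s * (1 - B y) := by rw [hBy]; linarith

/-- If `F` is the distribution function of a nonnegative random variable (with law `ν`)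
with mean `1/μ` satisfying `sup_{x≥0,y≥0} |F_y(x) - F(x)| < ε`, and
`B(x) = p F(x) + (1-p)(1 - e^{-μx})` with `0 < p ≤ 1`, then
`sup_{x≥0,y≥0} |B_y(x) - B(x)| < 5ε`. -/
theorem losses_condition_A_uniform_bound
    (μ ε p : ℝ) (hμ : 0 < μ) (hε : 0 < ε) (hp0 : 0 < p) (hp1 : p ≤ 1)
    (ν : Measure ℝ) [IsProbabilityMeasure ν] (hν : ν (Set.Iio 0) = 0)
    (F : ℝ → ℝ) (hF : ∀ x, F x = (ν (Set.Iic x)).toReal)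
    (hint : Integrable (fun x => x) ν)
    (hmean : ∫ x, x ∂ν = 1 / μ)
    (hsup : sSup {d : ℝ | ∃ x ≥ (0:ℝ), ∃ y ≥ (0:ℝ), d = |condF F y x - F x|} < ε)
    (B : ℝ → ℝ)
    (hB : ∀ x, B x = p * F x + (1 - p) * (1 - Real.exp (-μ * x))) :
    sSup {d : ℝ | ∃ x ≥ (0:ℝ), ∃ y ≥ (0:ℝ), d = |condF B y x - B x|} < 5 * ε := by
  obtain rfl : F = ProbabilityTheory.cdf ν := funext fun x => by
    rw [hF, ProbabilityTheory.cdf_eq_real, measureReal_def]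
  have hmono : Monotone (ProbabilityTheory.cdf ν) := ProbabilityTheory.monotone_cdf ν
  have hF1 := ProbabilityTheory.cdf_le_one ν
  set s := sSup {d : ℝ | ∃ x ≥ (0 : ℝ), ∃ y ≥ (0 : ℝ),
    d = |condF (ProbabilityTheory.cdf ν) y x - ProbabilityTheory.cdf ν x|} with hs_def
  have hle : ∀ x ≥ (0 : ℝ), ∀ y ≥ (0 : ℝ),
      |condF (ProbabilityTheory.cdf ν) y x - ProbabilityTheory.cdf ν x| ≤ s := by
    intro x hx y hy
    refine le_csSup ⟨1, ?_⟩ ⟨x, hx, y, hy, rfl⟩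
    rintro _ ⟨x, hx, y, -, rfl⟩
    have h := condF_mem_Icc hmono hF1 (y := y) hx
    rw [abs_le]
    constructor <;> linarith [h.1, h.2, hF1 x, ProbabilityTheory.cdf_nonneg ν x]
  have hs : 0 ≤ s := (abs_nonneg _).trans (hle 0 le_rfl 0 le_rfl)
  have hmul := fun x (hx : x ≥ (0 : ℝ)) y (hy : y ≥ (0 : ℝ)) =>
    tail_add_sub_mul_abs_le hmono hF1 hx (hle x hx y hy)
  have hmass : ∫ t in Ioi 0, (1 - ProbabilityTheory.cdf ν t) = 1 / μ :=
    (integral_Ioi_one_sub_cdf hν hint).trans hmean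
  have hG : IntegrableOn (fun t => 1 - ProbabilityTheory.cdf ν t) (Ioi 0) := by
    by_contra h
    rw [integral_undef h] at hmass
    exact (one_div_pos.2 hμ).ne hmass
  have hexp : ∀ x ≥ 0, |(1 - ProbabilityTheory.cdf ν x) - exp (-μ * x)| ≤ 2 * s := fun x hx =>
    abs_sub_exp_le_of_almost_multiplicative hμ hG (hmono.measurable.const_sub 1)
      (fun x => continuousWithinAt_const.sub ((ProbabilityTheory.cdf ν).right_continuous x))
      hmass hs hmul hx
  have hne : {d : ℝ | ∃ x ≥ (0 : ℝ), ∃ y ≥ (0 : ℝ), d = |condF B y x - B x|}.Nonempty :=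
    ⟨_, 0, le_rfl, 0, le_rfl, rfl⟩
  refine (csSup_le hne ?_).trans_lt (show 3 * s < 5 * ε by linarith)
  rintro _ ⟨x, hx, y, hy, rfl⟩
  rcases hp1.eq_or_lt with rfl | hp1
  · obtain rfl : B = ProbabilityTheory.cdf ν := funext fun x => by rw [hB]; ring
    linarith [hle x hx y hy]
  · exact abs_condF_mixture_sub_le hp0 hp1 hF1 hB hs (hmul x hx y hy) (hexp x hx)
end

section
/- Let μ > 0 and let F be the distribution function of a nonnegative random variable with mean 1/μ satisfying sup_{x≥0, y≥0} |F_y(x) − F(x)| < ε. Let B(x) = (1/2)·F(x) + (1/2)·(1 − e^{−μx}) be the distribution function of a nonnegative random variable χ. Then sup_{x≥0, y≥0} |B_y(x) − B(x)| < 2ε, where B_y(x) = Pr{χ ≤ x + y | χ > y}. -/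
open MeasureTheory Real Set

/-- If the ageing defect of a survival function `S` with mean `1 / μ` is at most `δ`, then `S` is
within `δ` of its integrated tail `1 - μ ∫₀ˣ S`. -/
lemma abs_sub_integrated_tail_le {S : ℝ → ℝ} {μ δ : ℝ} (hμ : 0 < μ)
    (hint : IntegrableOn S (Ioi 0)) (hmean : ∫ y in Ioi 0, S y = 1 / μ)
    (hS : ∀ x ≥ 0, ∀ y ≥ 0, |S (x + y) - S x * S y| ≤ δ * S y) {x : ℝ} (hx : 0 ≤ x) :
    |(1 - μ * ∫ u in (0 : ℝ)..x, S u) - S x| ≤ δ := by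
  have hmp := measurePreserving_add_left (volume : Measure ℝ) x
  have hemb := measurableEmbedding_addLeft x
  have hpre : (fun y => x + y) ⁻¹' Ioi x = Ioi 0 := by ext y; simp
  have hshift : IntegrableOn (fun y => S (x + y)) (Ioi 0) := by
    have := (hmp.integrableOn_comp_preimage hemb (f := S) (s := Ioi x)).2
      (hint.mono_set (Ioi_subset_Ioi hx))
    rwa [hpre] at this
  have hshift_eq : ∫ y in Ioi 0, S (x + y) = ∫ y in Ioi x, S y := by
    have := hmp.setIntegral_preimage_emb hemb S (Ioi x)
    rwa [hpre] at this
  have htail := intervalIntegral.integral_Ioi_sub_Ioi hint hx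
  have hle : |∫ y in Ioi 0, (S (x + y) - S x * S y)| ≤ ∫ y in Ioi 0, δ * S y := by
    rw [← Real.norm_eq_abs]
    refine norm_integral_le_of_norm_le (hint.const_mul δ) ?_
    filter_upwards [ae_restrict_mem measurableSet_Ioi] with y hy
    exact hS x hx y (le_of_lt hy)
  rw [integral_sub hshift (hint.const_mul _), integral_const_mul, integral_const_mul, hshift_eq,
    hmean] at hle
  rw [hmean] at htail
  have hfactor : (1 - μ * ∫ u in (0 : ℝ)..x, S u) - S x
      = μ * ((∫ y in Ioi x, S y) - S x * (1 / μ)) := by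
    rw [← htail]; field_simp; ring
  rw [hfactor, abs_mul, abs_of_pos hμ]
  calc μ * |(∫ y in Ioi x, S y) - S x * (1 / μ)| ≤ μ * (δ * (1 / μ)) := by gcongr
    _ = δ := by field_simp

/-- A Grönwall-type comparison: if `R = c - μ ∫₀ˣ S` satisfies `R ≤ S` on `[0, ∞)`, then
`R x ≤ c e^{-μ x}`. -/
lemma sub_integral_le_mul_exp {S : ℝ → ℝ} {μ c : ℝ} (hμ : 0 < μ)
    (hloc : LocallyIntegrable S) (hcont : ∀ x, ContinuousWithinAt S (Ici x) x)
    (hle : ∀ x ≥ 0, (c - μ * ∫ u in (0 : ℝ)..x, S u) ≤ S x) {x : ℝ} (hx : 0 ≤ x) :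
    c - μ * ∫ u in (0 : ℝ)..x, S u ≤ c * exp (-μ * x) := by
  have hii (a b : ℝ) : IntervalIntegrable S volume a b :=
    (hloc.integrableOn_isCompact isCompact_uIcc).intervalIntegrable
  have hprim : Continuous fun z => ∫ u in (0 : ℝ)..z, S u :=
    intervalIntegral.continuous_primitive hii 0
  have hderiv (z : ℝ) : HasDerivWithinAt
      (fun z => exp (μ * z) * (c - μ * ∫ u in (0 : ℝ)..z, S u))
      (exp (μ * z) * μ * (c - μ * ∫ u in (0 : ℝ)..z, S u) + exp (μ * z) * (-(μ * S z)))
      (Ici z) z := by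
    have hI : HasDerivWithinAt (fun z => ∫ u in (0 : ℝ)..z, S u) (S z) (Ici z) z :=
      intervalIntegral.integral_hasDerivWithinAt_right (hii 0 z) (t := Ioi z)
        (hloc.aestronglyMeasurable.stronglyMeasurableAtFilter)
        ((hcont z).mono Ioi_subset_Ici_self)
    have hE : HasDerivAt (fun z => exp (μ * z)) (exp (μ * z) * μ) z := by
      simpa using ((hasDerivAt_id z).const_mul μ).exp
    exact hE.hasDerivWithinAt.mul ((hI.const_mul μ).const_sub c)
  have key := image_le_of_deriv_right_le_deriv_boundary (a := 0) (b := x)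
    (f := fun z => exp (μ * z) * (c - μ * ∫ u in (0 : ℝ)..z, S u))
    (B := fun _ => c) (B' := fun _ => 0)
    (by fun_prop) (fun z _ => hderiv z) (by simp) continuousOn_const
    (fun z _ => hasDerivWithinAt_const _ _ _)
    (fun z hz => by
      have := mul_nonneg (mul_pos (exp_pos (μ * z)) hμ).le (sub_nonneg.2 (hle z hz.1))
      linarith)
    (right_mem_Icc.2 hx)
  rw [neg_mul, exp_neg, ← div_eq_mul_inv, le_div_iff₀ (exp_pos _), mul_comm]
  exact key

/-- A survival function with mean `1 / μ` and ageing defect at most `δ` is within `2δ` of the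
exponential survival function. -/
lemma abs_sub_exp_le {S : ℝ → ℝ} {μ δ : ℝ} (hμ : 0 < μ) (hδ : 0 ≤ δ)
    (hanti : Antitone S) (hcont : ∀ x, ContinuousWithinAt S (Ici x) x)
    (hint : IntegrableOn S (Ioi 0)) (hmean : ∫ y in Ioi 0, S y = 1 / μ)
    (hS : ∀ x ≥ 0, ∀ y ≥ 0, |S (x + y) - S x * S y| ≤ δ * S y) {x : ℝ} (hx : 0 ≤ x) :
    |S x - exp (-μ * x)| ≤ 2 * δ := by
  have hloc : LocallyIntegrable S := hanti.locallyIntegrable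
  have htail {z : ℝ} (hz : 0 ≤ z) := abs_le.1 (abs_sub_integrated_tail_le hμ hint hmean hS hz)
  have hupper := sub_integral_le_mul_exp (c := 1 - δ) hμ hloc hcont
    (fun z hz => by linarith [(htail hz).2]) hx
  have hlower := sub_integral_le_mul_exp (S := fun z => -S z) (c := -(1 + δ)) hμ hloc.neg
    (fun z => (hcont z).neg)
    (fun z hz => by rw [intervalIntegral.integral_neg]; linarith [(htail hz).1]) hx
  rw [intervalIntegral.integral_neg] at hlower
  have hpos : 0 ≤ δ * exp (-μ * x) := mul_nonneg hδ (exp_pos _).le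
  obtain ⟨h₁, h₂⟩ := htail hx
  rw [abs_le]
  constructor <;> linarith

/-- The conditional distribution function of a monotone function with values in `[0, 1]` again
takes values in `[0, 1]`, so it is within `1` of the original one. -/
lemma abs_condF_sub_le_one {F : ℝ → ℝ} (hmono : Monotone F) (h0 : ∀ x, 0 ≤ F x)
    (h1 : ∀ x, F x ≤ 1) {x y : ℝ} (hx : 0 ≤ x) : |condF F y x - F x| ≤ 1 := by
  have hnum : 0 ≤ F (x + y) - F y := sub_nonneg.2 (hmono (by linarith))
  have hden : 0 ≤ 1 - F y := sub_nonneg.2 (h1 y)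
  have hc0 : 0 ≤ condF F y x := div_nonneg hnum hden
  have hc1 : condF F y x ≤ 1 := div_le_one_of_le₀ (by linarith [h1 (x + y)]) hden
  exact abs_le.2 ⟨by linarith [h1 x], by linarith [h0 x]⟩

/-- Multiplicative form of a bound on `|F_y(x) - F(x)|` in terms of the survival function. -/
lemma abs_survival_sub_mul_le {F : ℝ → ℝ} {δ : ℝ} (hmono : Monotone F) (h1 : ∀ x, F x ≤ 1)
    {x y : ℝ} (hx : 0 ≤ x) (hle : |condF F y x - F x| ≤ δ) :
    |(1 - F (x + y)) - (1 - F x) * (1 - F y)| ≤ δ * (1 - F y) := by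
  have hFy : F y ≤ F (x + y) := hmono (by linarith)
  rcases (h1 y).eq_or_lt with hy | hy
  · have : F (x + y) = 1 := le_antisymm (h1 _) (hy ▸ hFy)
    simp [hy, this]
  · have hden : 0 < 1 - F y := sub_pos.2 hy
    have heq : (1 - F (x + y)) - (1 - F x) * (1 - F y) = -((condF F y x - F x) * (1 - F y)) := by
      rw [condF]; field_simp; ring
    rw [heq, abs_neg, abs_mul, abs_of_pos hden]
    gcongr

/-- The bound for the half-half mixture of `F` with the exponential distribution, at fixed points. -/
lemma abs_condF_half_sub_le {F B : ℝ → ℝ} {μ δ x y : ℝ} (hδ : 0 ≤ δ) (h1 : F y ≤ 1)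
    (hB : ∀ x, B x = (1 / 2) * F x + (1 / 2) * (1 - exp (-μ * x)))
    (hage : |(1 - F (x + y)) - (1 - F x) * (1 - F y)| ≤ δ * (1 - F y))
    (hexp : |(1 - F x) - exp (-μ * x)| ≤ 2 * δ) :
    |condF B y x - B x| ≤ 2 * δ := by
  have ha : 0 ≤ 1 - F y := sub_nonneg.2 h1
  have hb : 0 < exp (-μ * y) := exp_pos _
  set a := 1 - F y with ha_def
  set b := exp (-μ * y) with hb_def
  have hexp_add : exp (-μ * (x + y)) = exp (-μ * x) * b := by rw [mul_add, exp_add]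
  have hden : 1 - B y = (a + b) / 2 := by rw [hB]; ring
  have heq : condF B y x - B x
      = (2 * -((1 - F (x + y)) - (1 - F x) * a) + (b - a) * ((1 - F x) - exp (-μ * x)))
        / (2 * (a + b)) := by
    have hab : a + b ≠ 0 := by positivity
    have hFy : F y = 1 - a := by rw [ha_def]; ring
    rw [condF, hden, hB, hB, hB, hexp_add, hFy, ← hb_def]
    field_simp
    ring
  have hab : |b - a| ≤ a + b := abs_le.2 ⟨by linarith, by linarith⟩
  rw [heq, abs_div, abs_of_pos (by positivity : 0 < 2 * (a + b)), div_le_iff₀ (by positivity)]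
  calc |2 * -((1 - F (x + y)) - (1 - F x) * a) + (b - a) * ((1 - F x) - exp (-μ * x))|
      ≤ 2 * |(1 - F (x + y)) - (1 - F x) * a| + |b - a| * |(1 - F x) - exp (-μ * x)| := by
        refine (abs_add_le _ _).trans_eq ?_
        rw [abs_mul, abs_mul, abs_neg, abs_two]
    _ ≤ 2 * (δ * a) + (a + b) * (2 * δ) := by gcongr
    _ ≤ 2 * δ * (2 * (a + b)) := by nlinarith [mul_nonneg hδ hb.le]


/-- If `F` is the distribution function of a nonnegative random variable (with law `ν`)
with mean `1/μ` satisfying `sup_{x≥0,y≥0} |F_y(x) - F(x)| < ε`, and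
`B(x) = (1/2) F(x) + (1/2)(1 - e^{-μx})`, then
`sup_{x≥0,y≥0} |B_y(x) - B(x)| < 2ε`. -/
theorem losses_condition_A_half_bound
    (μ ε : ℝ) (hμ : 0 < μ) (hε : 0 < ε)
    (ν : Measure ℝ) [IsProbabilityMeasure ν] (hν : ν (Set.Iio 0) = 0)
    (F : ℝ → ℝ) (hF : ∀ x, F x = (ν (Set.Iic x)).toReal)
    (hint : Integrable (fun x => x) ν)
    (hmean : ∫ x, x ∂ν = 1 / μ)
    (hsup : sSup {d : ℝ | ∃ x ≥ (0:ℝ), ∃ y ≥ (0:ℝ), d = |condF F y x - F x|} < ε)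
    (B : ℝ → ℝ)
    (hB : ∀ x, B x = (1 / 2) * F x + (1 / 2) * (1 - Real.exp (-μ * x))) :
    sSup {d : ℝ | ∃ x ≥ (0:ℝ), ∃ y ≥ (0:ℝ), d = |condF B y x - B x|} < 2 * ε := by
  have hFcdf : F = ProbabilityTheory.cdf ν := by
    ext x; rw [hF, ProbabilityTheory.cdf_eq_real]; rfl
  have hmono : Monotone F := hFcdf ▸ ProbabilityTheory.monotone_cdf ν
  have h0 (x : ℝ) : 0 ≤ F x := hFcdf ▸ ProbabilityTheory.cdf_nonneg ν x
  have h1 (x : ℝ) : F x ≤ 1 := hFcdf ▸ ProbabilityTheory.cdf_le_one ν x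
  have hcont (x : ℝ) : ContinuousWithinAt (fun z => 1 - F z) (Ici x) x :=
    continuousWithinAt_const.sub (hFcdf ▸ (ProbabilityTheory.cdf ν).right_continuous x)
  have hsurv (t : ℝ) : ν.real {a | t < a} = 1 - F t := by
    rw [hF, ← measureReal_def, ← probReal_compl_eq_one_sub measurableSet_Iic, compl_Iic]; rfl
  have hnonneg : 0 ≤ᵐ[ν] fun x => x := by
    rw [Filter.EventuallyLE, ae_iff]
    simpa [Iio] using hν
  have hmean' : ∫ t in Ioi 0, (1 - F t) = 1 / μ := by
    rw [← hmean, hint.integral_eq_integral_meas_lt hnonneg]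
    simp only [hsurv]
  have hint' : IntegrableOn (fun t => 1 - F t) (Ioi 0) :=
    Integrable.of_integral_ne_zero (by rw [hmean']; positivity)
  set D := {d : ℝ | ∃ x ≥ (0:ℝ), ∃ y ≥ (0:ℝ), d = |condF F y x - F x|} with hD
  have hbdd : BddAbove D :=
    ⟨1, by rintro _ ⟨x, hx, y, -, rfl⟩; exact abs_condF_sub_le_one hmono h0 h1 hx⟩
  have hδ : 0 ≤ sSup D := Real.sSup_nonneg (by rintro _ ⟨x, -, y, -, rfl⟩; exact abs_nonneg _)
  have hage : ∀ x ≥ 0, ∀ y ≥ 0,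
      |(1 - F (x + y)) - (1 - F x) * (1 - F y)| ≤ sSup D * (1 - F y) := fun x hx y hy =>
    abs_survival_sub_mul_le hmono h1 hx (le_csSup hbdd ⟨x, hx, y, hy, rfl⟩)
  have hexp {x : ℝ} (hx : 0 ≤ x) : |(1 - F x) - exp (-μ * x)| ≤ 2 * sSup D :=
    abs_sub_exp_le hμ hδ (fun _ _ h => sub_le_sub_left (hmono h) 1) hcont hint' hmean' hage hx
  have hle : sSup {d : ℝ | ∃ x ≥ (0:ℝ), ∃ y ≥ (0:ℝ), d = |condF B y x - B x|} ≤ 2 * sSup D := by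
    refine csSup_le ⟨_, 0, le_rfl, 0, le_rfl, rfl⟩ ?_
    rintro _ ⟨x, hx, y, hy, rfl⟩
    exact abs_condF_half_sub_le hδ (h1 y) hB (hage x hx y hy) (hexp hx)
  linarith
end

section
/- Let ζ be a nonnegative random variable with cumulative distribution function F and mean 1/μ (μ > 0) such that sup_{x≥0, y≥0} |F_y(x) − F(x)| < ε, and suppose in addition that F belongs either to the class NBU or to the class NWU. Then sup_{x≥0} |F(x) − (1 − e^{−μx})| < ε. -/
open MeasureTheory Real Set

/-- A distribution function `Ξ` of a nonnegative random variable is NBU (new better than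
used) if `Ξ̄(x+y) ≤ Ξ̄(x)·Ξ̄(y)` for all `x, y ≥ 0`. -/
def IsNBU (Ξ : ℝ → ℝ) : Prop :=
  ∀ x ≥ (0:ℝ), ∀ y ≥ (0:ℝ), 1 - Ξ (x + y) ≤ (1 - Ξ x) * (1 - Ξ y)

/-- A distribution function `Ξ` of a nonnegative random variable is NWU (new worse than
used) if `Ξ̄(x+y) ≥ Ξ̄(x)·Ξ̄(y)` for all `x, y ≥ 0`. -/
def IsNWU (Ξ : ℝ → ℝ) : Prop :=
  ∀ x ≥ (0:ℝ), ∀ y ≥ (0:ℝ), (1 - Ξ x) * (1 - Ξ y) ≤ 1 - Ξ (x + y)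

/-- A one-sided Grönwall inequality: if the right derivative of `H` is at most `-μ (H - c)`,
then `H - c` decays at least as fast as `e^{-μx}`. -/
theorem sub_le_mul_exp_of_hasDerivWithinAt_le {μ c : ℝ} {H H' : ℝ → ℝ}
    (hcont : ContinuousOn H (Ici 0))
    (hderiv : ∀ t ≥ (0:ℝ), HasDerivWithinAt H (H' t) (Ici t) t)
    (hle : ∀ t ≥ (0:ℝ), H' t ≤ -μ * (H t - c)) {x : ℝ} (hx : 0 ≤ x) :
    H x - c ≤ (H 0 - c) * Real.exp (-μ * x) := by
  have key : Real.exp (μ * x) * (H x - c) ≤ H 0 - c := by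
    have hexp (t : ℝ) : HasDerivAt (fun s => Real.exp (μ * s)) (Real.exp (μ * t) * μ) t := by
      simpa using ((hasDerivAt_id t).const_mul μ).exp
    refine image_le_of_deriv_right_le_deriv_boundary
      (f := fun t => Real.exp (μ * t) * (H t - c))
      (f' := fun t => Real.exp (μ * t) * μ * (H t - c) + Real.exp (μ * t) * H' t)
      (B := fun _ => H 0 - c) (B' := fun _ => 0) (a := 0) (b := x)
      ?_ ?_ (by simp) continuousOn_const
      (fun t _ => hasDerivWithinAt_const _ _ _) ?_ ⟨hx, le_rfl⟩
    · exact (by fun_prop : Continuous fun t => Real.exp (μ * t)).continuousOn.mul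
        ((hcont.mono Icc_subset_Ici_self).sub continuousOn_const)
    · exact fun t ht => (hexp t).hasDerivWithinAt.mul ((hderiv t ht.1).sub_const c)
    · intro t ht
      have := mul_le_mul_of_nonneg_left (hle t ht.1) (Real.exp_pos (μ * t)).le
      linarith
  calc H x - c = Real.exp (μ * x) * (H x - c) * Real.exp (-μ * x) := by
        rw [mul_right_comm, ← Real.exp_add]; simp
    _ ≤ (H 0 - c) * Real.exp (-μ * x) :=
        mul_le_mul_of_nonneg_right key (Real.exp_pos _).le

/-- A one-sided Grönwall inequality: if the right derivative of `H` is at least `-μ (H - c)`,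
then `H - c` decays at most as fast as `e^{-μx}`. -/
theorem mul_exp_le_sub_of_le_hasDerivWithinAt {μ c : ℝ} {H H' : ℝ → ℝ}
    (hcont : ContinuousOn H (Ici 0))
    (hderiv : ∀ t ≥ (0:ℝ), HasDerivWithinAt H (H' t) (Ici t) t)
    (hle : ∀ t ≥ (0:ℝ), -μ * (H t - c) ≤ H' t) {x : ℝ} (hx : 0 ≤ x) :
    (H 0 - c) * Real.exp (-μ * x) ≤ H x - c := by
  have := sub_le_mul_exp_of_hasDerivWithinAt_le (μ := μ) (c := -c) hcont.neg
    (fun t ht => (hderiv t ht).neg)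
    (fun t ht => by simp only [Pi.neg_apply]; linarith [hle t ht]) hx
  simp only [Pi.neg_apply] at this
  linarith

/-- A survival function `G` with mean `1/μ` that is submultiplicative or supermultiplicative, and
multiplicative up to a relative error `δ`, is within `δ` of the exponential survival function. -/
theorem abs_sub_exp_le_of_almost_multiplicative_s3 {μ δ : ℝ} {G : ℝ → ℝ} (hμ : 0 < μ) (hδ : 0 ≤ δ)
    (hanti : Antitone G) (hright : ∀ t, ContinuousWithinAt G (Ici t) t)
    (hint : IntegrableOn G (Ioi 0)) (hmean : ∫ t in Ioi 0, G t = 1 / μ)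
    (hmul : ∀ x ≥ (0:ℝ), ∀ y ≥ (0:ℝ), |G (x + y) - G x * G y| ≤ δ * G y)
    (hclass : (∀ x ≥ (0:ℝ), ∀ y ≥ (0:ℝ), G (x + y) ≤ G x * G y) ∨
      ∀ x ≥ (0:ℝ), ∀ y ≥ (0:ℝ), G x * G y ≤ G (x + y))
    {x : ℝ} (hx : 0 ≤ x) : |G x - Real.exp (-μ * x)| ≤ δ := by
  let H : ℝ → ℝ := fun t => 1 - μ * ∫ s in 0..t, G s
  have hii (a b : ℝ) : IntervalIntegrable G volume a b := hanti.intervalIntegrable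
  have hH0 : H 0 = 1 := by simp [H]
  have hcont : ContinuousOn H (Ici 0) :=
    (continuous_const.sub
      (continuous_const.mul (intervalIntegral.continuous_primitive hii 0))).continuousOn
  have hderiv : ∀ t ≥ (0:ℝ), HasDerivWithinAt H (-(μ * G t)) (Ici t) t := fun t _ =>
    ((intervalIntegral.integral_hasDerivWithinAt_right (hii 0 t)
      (hanti.measurable.stronglyMeasurable.stronglyMeasurableAtFilter)
      ((hright t).mono Ioi_subset_Ici_self)).const_mul μ).const_sub 1
  have hshift (t : ℝ) : MeasurePreserving (fun y => t + y) volume volume :=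
    measurePreserving_add_left volume t
  have hemb (t : ℝ) : MeasurableEmbedding fun y : ℝ => t + y := measurableEmbedding_addLeft t
  have hpre (t : ℝ) : (fun y => t + y) ⁻¹' Ioi t = Ioi 0 := by ext; simp
  have htail {t : ℝ} (ht : 0 ≤ t) : IntegrableOn (fun y => G (t + y)) (Ioi 0) := by
    rw [← hpre t]
    exact ((hshift t).integrableOn_comp_preimage (hemb t)).2 (hint.mono_set (Ioi_subset_Ioi ht))
  have hH {t : ℝ} (ht : 0 ≤ t) : H t = μ * ∫ y in Ioi 0, G (t + y) := by
    have hsplit := intervalIntegral.integral_interval_add_Ioi hint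
      (hint.mono_set (Ioi_subset_Ioi ht))
    have htranslate : ∫ y in Ioi 0, G (t + y) = ∫ y in Ioi t, G y := by
      rw [← hpre t]
      exact (hshift t).setIntegral_preimage_emb (hemb t) G (Ioi t)
    have hone : μ * (1 / μ) = 1 := by field_simp
    rw [htranslate, eq_sub_of_add_eq' hsplit, hmean, mul_sub, hone]
  have hscale (c : ℝ) : μ * ∫ y in Ioi 0, c * G y = c := by
    rw [integral_const_mul, hmean]; field_simp
  have le_H {t c : ℝ} (ht : 0 ≤ t) (h : ∀ y ≥ (0:ℝ), c * G y ≤ G (t + y)) : c ≤ H t := by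
    rw [hH ht, ← hscale c]
    exact mul_le_mul_of_nonneg_left (setIntegral_mono_on (hint.const_mul c) (htail ht)
      measurableSet_Ioi fun y hy => h y (le_of_lt hy)) hμ.le
  have H_le {t c : ℝ} (ht : 0 ≤ t) (h : ∀ y ≥ (0:ℝ), G (t + y) ≤ c * G y) : H t ≤ c := by
    rw [hH ht, ← hscale c]
    exact mul_le_mul_of_nonneg_left (setIntegral_mono_on (htail ht) (hint.const_mul c)
      measurableSet_Ioi fun y hy => h y (le_of_lt hy)) hμ.le
  have hlow : ∀ t ≥ (0:ℝ), G t - δ ≤ H t := fun t ht => le_H ht fun y hy => by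
    linarith [(abs_le.1 (hmul t ht y hy)).1]
  have hupp : ∀ t ≥ (0:ℝ), H t ≤ G t + δ := fun t ht => H_le ht fun y hy => by
    linarith [(abs_le.1 (hmul t ht y hy)).2]
  have hpos : 0 ≤ δ * Real.exp (-μ * x) := by positivity
  rw [abs_le]
  rcases hclass with h | h
  · have hHG : ∀ t ≥ (0:ℝ), H t ≤ G t := fun t ht => H_le ht (h t ht)
    have h1 := sub_le_mul_exp_of_hasDerivWithinAt_le (μ := μ) (c := 0) hcont hderiv
      (fun t ht => by nlinarith [hHG t ht]) hx
    have h2 := mul_exp_le_sub_of_le_hasDerivWithinAt (μ := μ) (c := -δ) hcont hderiv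
      (fun t ht => by nlinarith [hlow t ht]) hx
    rw [hH0] at h1 h2
    constructor <;> linarith [hHG x hx, hlow x hx]
  · have hGH : ∀ t ≥ (0:ℝ), G t ≤ H t := fun t ht => le_H ht (h t ht)
    have h1 := mul_exp_le_sub_of_le_hasDerivWithinAt (μ := μ) (c := 0) hcont hderiv
      (fun t ht => by nlinarith [hGH t ht]) hx
    have h2 := sub_le_mul_exp_of_hasDerivWithinAt_le (μ := μ) (c := δ) hcont hderiv
      (fun t ht => by nlinarith [hupp t ht]) hx
    rw [hH0] at h1 h2
    constructor <;> linarith [hGH x hx, hupp x hx]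

/-- If `ζ` is a nonnegative random variable (with law `ν`) with distribution function
`F` and mean `1/μ` such that `sup_{x≥0,y≥0} |F_y(x) - F(x)| < ε`, and `F` is NBU or NWU,
then `sup_{x≥0} |F(x) - (1 - e^{-μx})| < ε`. -/
theorem characterization_under_NBU_or_NWU
    (μ ε : ℝ) (hμ : 0 < μ) (hε : 0 < ε)
    (ν : Measure ℝ) [IsProbabilityMeasure ν] (hν : ν (Set.Iio 0) = 0)
    (F : ℝ → ℝ) (hF : ∀ x, F x = (ν (Set.Iic x)).toReal)
    (hint : Integrable (fun x => x) ν)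
    (hmean : ∫ x, x ∂ν = 1 / μ)
    (hsup : sSup {d : ℝ | ∃ x ≥ (0:ℝ), ∃ y ≥ (0:ℝ), d = |condF F y x - F x|} < ε)
    (hclass : IsNBU F ∨ IsNWU F) :
    sSup {d : ℝ | ∃ x ≥ (0:ℝ), d = |F x - (1 - Real.exp (-μ * x))|} < ε := by
  have hFcdf : F = ProbabilityTheory.cdf ν := by
    funext x; rw [hF, ProbabilityTheory.cdf_eq_real, measureReal_def]
  have hmono : Monotone F := hFcdf ▸ ProbabilityTheory.monotone_cdf ν
  have hF0 (x : ℝ) : 0 ≤ F x := hFcdf ▸ ProbabilityTheory.cdf_nonneg ν x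
  have hF1 (x : ℝ) : F x ≤ 1 := hFcdf ▸ ProbabilityTheory.cdf_le_one ν x
  have hright (t : ℝ) : ContinuousWithinAt F (Ici t) t :=
    hFcdf ▸ (ProbabilityTheory.cdf ν).right_continuous t
  have hbdd : BddAbove {d : ℝ | ∃ x ≥ (0:ℝ), ∃ y ≥ (0:ℝ), d = |condF F y x - F x|} := by
    refine ⟨1, ?_⟩
    rintro _ ⟨x, hx, y, -, rfl⟩
    have h0 : 0 ≤ condF F y x :=
      div_nonneg (sub_nonneg.2 (hmono (by linarith))) (sub_nonneg.2 (hF1 y))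
    have h1 : condF F y x ≤ 1 :=
      div_le_one_of_le₀ (by linarith [hF1 (x + y)]) (sub_nonneg.2 (hF1 y))
    rw [abs_le]
    constructor <;> linarith [hF0 x, hF1 x]
  set δ := sSup {d : ℝ | ∃ x ≥ (0:ℝ), ∃ y ≥ (0:ℝ), d = |condF F y x - F x|}
  have hcond {x y : ℝ} (hx : 0 ≤ x) (hy : 0 ≤ y) : |condF F y x - F x| ≤ δ :=
    le_csSup hbdd ⟨x, hx, y, hy, rfl⟩
  have hδ : 0 ≤ δ := (abs_nonneg _).trans (hcond le_rfl le_rfl)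
  have hmul : ∀ x ≥ (0:ℝ), ∀ y ≥ (0:ℝ),
      |(1 - F (x + y)) - (1 - F x) * (1 - F y)| ≤ δ * (1 - F y) := by
    intro x hx y hy
    rcases (hF1 y).lt_or_eq with hlt | heq
    · have hpos : 0 < 1 - F y := sub_pos.2 hlt
      have hrw : (1 - F (x + y)) - (1 - F x) * (1 - F y)
          = -(condF F y x - F x) * (1 - F y) := by
        rw [condF]; field_simp; ring
      rw [hrw, abs_mul, abs_neg, abs_of_pos hpos]
      exact mul_le_mul_of_nonneg_right (hcond hx hy) hpos.le
    · have : F (x + y) = 1 := le_antisymm (hF1 _) (heq ▸ hmono (by linarith))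
      simp [heq, this]
  have hmeanG : ∫ t in Ioi 0, (1 - F t) = 1 / μ := by
    have hnn : 0 ≤ᵐ[ν] fun x : ℝ => x := by
      rw [Filter.EventuallyLE, ae_iff]
      simpa [Iio] using hν
    rw [← hmean, hint.integral_eq_integral_meas_lt hnn]
    refine integral_congr_ae (Filter.Eventually.of_forall fun t => ?_)
    have hcompl : {a : ℝ | t < a} = (Iic t)ᶜ := by ext; simp
    simp only [hcompl, probReal_compl_eq_one_sub measurableSet_Iic, hF, measureReal_def]
  have hintG : IntegrableOn (fun t => 1 - F t) (Ioi 0) :=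
    Integrable.of_integral_ne_zero (by rw [hmeanG]; positivity)
  refine lt_of_le_of_lt (csSup_le ⟨_, 0, le_rfl, rfl⟩ ?_) hsup
  rintro _ ⟨x, hx, rfl⟩
  have := abs_sub_exp_le_of_almost_multiplicative_s3 (G := fun t => 1 - F t) hμ hδ
    (fun a b hab => sub_le_sub_left (hmono hab) 1)
    (fun t => continuousWithinAt_const.sub (hright t)) hintG hmeanG hmul hclass hx
  rw [abs_sub_comm] at this
  rwa [show F x - (1 - Real.exp (-μ * x)) = Real.exp (-μ * x) - (1 - F x) by ring]
end

section
/- Let μ > 0 and let F be the distribution function of a nonnegative random variable with mean 1/μ satisfying sup_{x≥0, y≥0} |F_y(x) − F(x)| < ε, and suppose F belongs either to the class NBU or to the class NWU. Let B(x) = (1/2)·F(x) + (1/2)·(1 − e^{−μx}) be the distribution function of a nonnegative random variable χ. Then sup_{x≥0, y≥0} |B_y(x) − B(x)| < (3/2)ε, where B_y(x) = Pr{χ ≤ x + y | χ > y}. -/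
open MeasureTheory Real Set

/-- A Grönwall-type bound for right derivatives: `G' ≤ -k G` implies `G x ≤ G 0 * exp (-k x)`. -/
theorem le_mul_exp_neg_of_right_deriv_le {k : ℝ} {G G' : ℝ → ℝ} (hG : Continuous G)
    (hG' : ∀ x ≥ 0, HasDerivWithinAt G (G' x) (Ici x) x) (hle : ∀ x ≥ 0, G' x ≤ -k * G x)
    {x : ℝ} (hx : 0 ≤ x) : G x ≤ G 0 * exp (-k * x) := by
  have hder : ∀ z : ℝ, HasDerivAt (fun z => exp (k * z)) (exp (k * z) * k) z := fun z => by
    simpa using ((hasDerivAt_id z).const_mul k).exp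
  have key := image_le_of_deriv_right_le_deriv_boundary (a := 0) (b := x)
    (f := fun z => G z * exp (k * z)) (f' := fun z => G' z * exp (k * z) + G z * (exp (k * z) * k))
    (B := fun _ => G 0) (B' := fun _ => 0) (by fun_prop)
    (fun z hz => (hG' z hz.1).mul (hder z).hasDerivWithinAt) (by simp) continuousOn_const
    (fun z _ => hasDerivWithinAt_const _ _ _)
    (fun z hz => by nlinarith [hle z hz.1, exp_pos (k * z)]) ⟨hx, le_rfl⟩
  rw [neg_mul, exp_neg, ← div_eq_mul_inv, le_div_iff₀ (exp_pos _)]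
  exact key

/-- If the tail `f` of a lifetime with mean `1 / k` satisfies
`a * f y ≤ f (x + y) - f x * f y ≤ b * f y` with `a ≤ 0 ≤ b`, then `f` is uniformly within
`b - a` of the exponential tail with the same mean. -/
theorem abs_sub_exp_neg_le_of_memoryless_defect {k a b : ℝ} (hk : 0 < k) (ha : a ≤ 0) (hb : 0 ≤ b)
    {f : ℝ → ℝ} (hf : Antitone f) (hcont : ∀ x, ContinuousWithinAt f (Ici x) x)
    (hint : IntegrableOn f (Ioi 0)) (hmean : ∫ y in Ioi 0, f y = 1 / k)
    (hlow : ∀ x ≥ 0, ∀ y ≥ 0, a * f y ≤ f (x + y) - f x * f y)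
    (hupp : ∀ x ≥ 0, ∀ y ≥ 0, f (x + y) - f x * f y ≤ b * f y) {x : ℝ} (hx : 0 ≤ x) :
    |f x - exp (-k * x)| ≤ b - a := by
  have hii : ∀ u v, IntervalIntegrable f volume u v := fun _ _ => hf.intervalIntegrable
  set g : ℝ → ℝ := fun z => 1 - k * ∫ t in (0 : ℝ)..z, f t with hg
  have hgc : Continuous g := by
    have := intervalIntegral.continuous_primitive hii 0
    fun_prop
  have hgd : ∀ z, HasDerivWithinAt g (-(k * f z)) (Ici z) z := fun z => by
    have := intervalIntegral.integral_hasDerivWithinAt_right (s := Ici z) (t := Ioi z) (hii 0 z)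
      hf.measurable.stronglyMeasurable.stronglyMeasurableAtFilter
      ((hcont z).mono Ioi_subset_Ici_self)
    simpa [hg] using (this.const_mul k).const_sub 1
  have hshift : ∀ z ≥ 0, IntegrableOn (fun y => f (z + y)) (Ioi 0) ∧
      k * ∫ y in Ioi 0, f (z + y) = g z := fun z hz => by
    have hpre : (fun y => z + y) ⁻¹' Ioi z = Ioi 0 := by ext; simp
    have hmp := measurePreserving_add_left (volume : Measure ℝ) z
    have hemb := measurableEmbedding_addLeft z
    have hz' : IntegrableOn f (Ioi z) := hint.mono_set (Ioi_subset_Ioi hz)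
    constructor
    · rw [← hpre]
      exact (hmp.integrableOn_comp_preimage hemb).2 hz'
    · have h₁ := hmp.setIntegral_preimage_emb hemb f (Ioi z)
      rw [hpre] at h₁
      have h₂ := intervalIntegral.integral_interval_add_Ioi hint hz'
      rw [hmean] at h₂
      rw [h₁, hg, eq_sub_of_add_eq' h₂]
      field_simp
  have hgf : ∀ z ≥ 0, a ≤ g z - f z ∧ g z - f z ≤ b := fun z hz => by
    obtain ⟨hi, heq⟩ := hshift z hz
    have hdiff : k * ∫ y in Ioi 0, (f (z + y) - f z * f y) = g z - f z := by
      rw [integral_sub hi (hint.const_mul _), integral_const_mul, hmean, mul_sub, heq]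
      field_simp
    have hdi : IntegrableOn (fun y => f (z + y) - f z * f y) (Ioi 0) := hi.sub (hint.const_mul _)
    have hconst : ∀ c : ℝ, k * ∫ y in Ioi 0, c * f y = c := fun c => by
      rw [integral_const_mul, hmean]
      field_simp
    rw [← hdiff]
    constructor
    · rw [← hconst a]
      exact mul_le_mul_of_nonneg_left (setIntegral_mono_on (hint.const_mul _) hdi
        measurableSet_Ioi fun y hy => hlow z hz y (le_of_lt hy)) hk.le
    · rw [← hconst b]
      exact mul_le_mul_of_nonneg_left (setIntegral_mono_on hdi (hint.const_mul _)
        measurableSet_Ioi fun y hy => hupp z hz y (le_of_lt hy)) hk.le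
  have hg0 : g 0 = 1 := by simp [hg]
  have hgu := le_mul_exp_neg_of_right_deriv_le (k := k) (G := fun z => g z - b)
    (by fun_prop) (fun z _ => (hgd z).sub_const b) (fun z hz => by nlinarith [(hgf z hz).2]) hx
  have hgl := le_mul_exp_neg_of_right_deriv_le (k := k) (G := fun z => a - g z)
    (by fun_prop) (fun z _ => (hgd z).const_sub a) (fun z hz => by nlinarith [(hgf z hz).1]) hx
  simp only [hg0] at hgu hgl
  have he := exp_pos (-k * x)
  obtain ⟨h₁, h₂⟩ := hgf x hx
  rw [abs_le]
  constructor <;> nlinarith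

/-- The memoryless defect of the tail of `F` is controlled by the supremum of `|F_y - F|`. -/
theorem abs_tail_add_sub_mul_le_sSup {F : ℝ → ℝ} (hmono : Monotone F) (h0 : ∀ x, 0 ≤ F x)
    (h1 : ∀ x, F x ≤ 1) {x y : ℝ} (hx : 0 ≤ x) (hy : 0 ≤ y) :
    |(1 - F (x + y)) - (1 - F x) * (1 - F y)| ≤
      sSup {d : ℝ | ∃ x ≥ (0:ℝ), ∃ y ≥ (0:ℝ), d = |condF F y x - F x|} * (1 - F y) := by
  have hbdd : BddAbove {d : ℝ | ∃ x ≥ (0:ℝ), ∃ y ≥ (0:ℝ), d = |condF F y x - F x|} := by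
    refine ⟨1, ?_⟩
    rintro d ⟨u, hu, v, hv, rfl⟩
    have hm : F v ≤ F (u + v) := hmono (by linarith)
    have hc0 : 0 ≤ condF F v u := div_nonneg (by linarith) (by linarith [h1 v])
    have hc1 : condF F v u ≤ 1 :=
      div_le_one_of_le₀ (by linarith [h1 (u + v)]) (by linarith [h1 v])
    rw [abs_le]
    constructor <;> linarith [h0 u, h1 u]
  have hle := le_csSup hbdd ⟨x, hx, y, hy, rfl⟩
  rcases (h1 y).lt_or_eq with hlt | heq
  · have hpos : 0 < 1 - F y := by linarith
    have hrw : (1 - F (x + y)) - (1 - F x) * (1 - F y) = -(condF F y x - F x) * (1 - F y) := by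
      unfold condF
      field_simp
      ring
    rw [hrw, abs_mul, abs_neg, abs_of_pos hpos]
    exact mul_le_mul_of_nonneg_right hle hpos.le
  · have hm : F y ≤ F (x + y) := hmono (by linarith)
    have : F (x + y) = 1 := le_antisymm (h1 _) (heq ▸ hm)
    simp [this, heq]

/-- Mixing two tails at a pair of points: `p, p'` and `r` are the values of one tail at `x`, `y`
and `x + y`, while `q, q'` are those of an exponential tail at `x` and `y`. -/
theorem abs_half_mixture_defect_le {s p p' q q' r : ℝ} (hp' : 0 ≤ p') (hq' : 0 < q')
    (hr : |r - p * p'| ≤ s * p') (hpq : |p - q| ≤ s) :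
    |(p + q) / 2 - ((r + q * q') / 2) / ((p' + q') / 2)| ≤ 3 / 2 * s := by
  have hs : 0 ≤ s := (abs_nonneg _).trans hpq
  have hb : 0 < (p' + q') / 2 := by linarith
  have hprod : |(p - q) * (p' - q')| ≤ s * (p' + q') := by
    rw [abs_mul]
    exact mul_le_mul hpq (abs_le.2 ⟨by linarith, by linarith⟩) (abs_nonneg _) hs
  have hrw : (p + q) / 2 - ((r + q * q') / 2) / ((p' + q') / 2) =
      (-(r - p * p') / 2 - (p - q) * (p' - q') / 4) / ((p' + q') / 2) := by
    field_simp
    ring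
  rw [hrw, abs_div, abs_of_pos hb, div_le_iff₀ hb]
  rw [abs_le] at hr hprod ⊢
  have := mul_nonneg hs hp'
  have := mul_nonneg hs hq'.le
  constructor <;> nlinarith

/-- If `F` is the distribution function of a nonnegative random variable (with law `ν`)
with mean `1/μ` satisfying `sup_{x≥0,y≥0} |F_y(x) - F(x)| < ε`, `F` is NBU or NWU, and
`B(x) = (1/2) F(x) + (1/2)(1 - e^{-μx})`, then
`sup_{x≥0,y≥0} |B_y(x) - B(x)| < (3/2)ε`. -/
theorem losses_condition_B_half_bound
    (μ ε : ℝ) (hμ : 0 < μ) (hε : 0 < ε)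
    (ν : Measure ℝ) [IsProbabilityMeasure ν] (hν : ν (Set.Iio 0) = 0)
    (F : ℝ → ℝ) (hF : ∀ x, F x = (ν (Set.Iic x)).toReal)
    (hint : Integrable (fun x => x) ν)
    (hmean : ∫ x, x ∂ν = 1 / μ)
    (hsup : sSup {d : ℝ | ∃ x ≥ (0:ℝ), ∃ y ≥ (0:ℝ), d = |condF F y x - F x|} < ε)
    (hclass : IsNBU F ∨ IsNWU F)
    (B : ℝ → ℝ)
    (hB : ∀ x, B x = (1 / 2) * F x + (1 / 2) * (1 - Real.exp (-μ * x))) :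
    sSup {d : ℝ | ∃ x ≥ (0:ℝ), ∃ y ≥ (0:ℝ), d = |condF B y x - B x|} < (3 / 2) * ε := by
  set s := sSup {d : ℝ | ∃ x ≥ (0:ℝ), ∃ y ≥ (0:ℝ), d = |condF F y x - F x|} with hs
  have hFcdf : F = ProbabilityTheory.cdf ν := by
    ext x
    rw [hF, ProbabilityTheory.cdf_eq_real, measureReal_def]
  have hmono : Monotone F := hFcdf ▸ ProbabilityTheory.monotone_cdf ν
  have h0 : ∀ x, 0 ≤ F x := fun x => hFcdf ▸ ProbabilityTheory.cdf_nonneg ν x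
  have h1 : ∀ x, F x ≤ 1 := fun x => hFcdf ▸ ProbabilityTheory.cdf_le_one ν x
  have hs0 : 0 ≤ s := Real.sSup_nonneg (by rintro d ⟨x, -, y, -, rfl⟩; exact abs_nonneg _)
  have hdefect : ∀ x ≥ 0, ∀ y ≥ 0,
      |(1 - F (x + y)) - (1 - F x) * (1 - F y)| ≤ s * (1 - F y) :=
    fun x hx y hy => abs_tail_add_sub_mul_le_sSup hmono h0 h1 hx hy
  have hanti : Antitone fun x => 1 - F x := fun x y hxy => sub_le_sub_left (hmono hxy) 1
  have hcont : ∀ x, ContinuousWithinAt (fun x => 1 - F x) (Ici x) x := fun x =>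
    continuousWithinAt_const.sub (hFcdf ▸ (ProbabilityTheory.cdf ν).right_continuous x)
  have htail : ∫ y in Ioi 0, (1 - F y) = 1 / μ := by
    have hnn : 0 ≤ᵐ[ν] fun x => x := by
      rw [Filter.EventuallyLE, ae_iff]
      simpa [Set.Iio] using hν
    rw [← hmean, hint.integral_eq_integral_meas_lt hnn]
    congr 1 with y
    have hcompl : {a : ℝ | y < a} = (Iic y)ᶜ := by ext; simp
    rw [hcompl, probReal_compl_eq_one_sub measurableSet_Iic, hF, measureReal_def]
  have htailint : IntegrableOn (fun y => 1 - F y) (Ioi 0) := by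
    by_contra h
    rw [integral_undef h] at htail
    exact (one_div_pos.2 hμ).ne htail
  have hclose : ∀ x ≥ 0, |(1 - F x) - exp (-μ * x)| ≤ s := fun x hx => by
    rcases hclass with h | h
    · have := abs_sub_exp_neg_le_of_memoryless_defect hμ (neg_nonpos.2 hs0) le_rfl hanti hcont
        htailint htail
        (fun x hx y hy => by linarith [(abs_le.1 (hdefect x hx y hy)).1])
        (fun x hx y hy => by linarith [h x hx y hy]) hx
      simpa using this
    · have := abs_sub_exp_neg_le_of_memoryless_defect hμ le_rfl hs0 hanti hcont
        htailint htail
        (fun x hx y hy => by linarith [h x hx y hy])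
        (fun x hx y hy => (abs_le.1 (hdefect x hx y hy)).2) hx
      simpa using this
  have hbound : sSup {d : ℝ | ∃ x ≥ (0:ℝ), ∃ y ≥ (0:ℝ), d = |condF B y x - B x|} ≤
      3 / 2 * s := by
    refine Real.sSup_le ?_ (by positivity)
    rintro d ⟨x, hx, y, hy, rfl⟩
    have key := abs_half_mixture_defect_le (sub_nonneg.2 (h1 y)) (exp_pos (-μ * y))
      (hdefect x hx y hy) (hclose x hx)
    have hden : 0 < (1 - F y) + exp (-μ * y) := by linarith [h1 y, exp_pos (-μ * y)]
    have hexp : exp (-μ * (x + y)) = exp (-μ * x) * exp (-μ * y) := by rw [mul_add, exp_add]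
    have hrw : condF B y x - B x = (1 - F x + exp (-μ * x)) / 2 -
        ((1 - F (x + y) + exp (-μ * x) * exp (-μ * y)) / 2) / ((1 - F y + exp (-μ * y)) / 2) := by
      have hBy : 1 - B y = (1 - F y + exp (-μ * y)) / 2 := by rw [hB]; ring
      have hBxy : B (x + y) - B y = (1 - F y + exp (-μ * y)) / 2 -
          (1 - F (x + y) + exp (-μ * x) * exp (-μ * y)) / 2 := by
        rw [hB, hB, hexp]; ring
      rw [condF, hBy, hBxy, sub_div, div_self (by linarith), hB]
      ring
    rwa [hrw]
  linarith
end

section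
/- Let χ be a nonnegative random variable with cumulative distribution function B, mean 1/μ (μ > 0), and suppose B belongs to the class NBU and satisfies sup_{x≥0, y≥0} |B_y(x) − B(x)| < ε. Then sup_{x≥0} |B(x) − (1 − e^{−μx})| < ε. -/
open MeasureTheory Real Set

/-- If `h` has right derivative `-μ G` on `[0, ∞)` with `h ≤ G ≤ h + δ` and `h 0 = 1`, then `G`
is within `δ` of the exponential survival function. -/
lemma abs_sub_exp_le_of_hasDerivWithinAt {μ δ : ℝ} (hμ : 0 < μ) {G h : ℝ → ℝ}
    (hc : Continuous h) (h0 : h 0 = 1)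
    (hd : ∀ x ≥ (0 : ℝ), HasDerivWithinAt h (-(μ * G x)) (Ici x) x)
    (hl : ∀ x ≥ (0 : ℝ), h x ≤ G x) (hu : ∀ x ≥ (0 : ℝ), G x ≤ h x + δ)
    {x : ℝ} (hx : 0 ≤ x) : |G x - exp (-μ * x)| ≤ δ := by
  have hδ : 0 ≤ δ := by linarith [hl x hx, hu x hx]
  have hexp (y : ℝ) : HasDerivWithinAt (fun t => exp (μ * t)) (exp (μ * y) * (μ * 1)) (Ici y) y :=
    (((hasDerivAt_id y).const_mul μ).exp).hasDerivWithinAt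
  have key1 : h x * exp (μ * x) ≤ 1 := by
    refine image_le_of_deriv_right_le_deriv_boundary (a := 0) (b := x)
      (f := fun t => h t * exp (μ * t)) (B := fun _ => 1) (B' := fun _ => 0)
      (by fun_prop) (fun y hy => (hd y hy.1).mul (hexp y)) (by simp [h0])
      (by fun_prop) (fun y _ => hasDerivWithinAt_const _ _ _) (fun y hy => ?_) ⟨hx, le_rfl⟩
    have := mul_nonneg (mul_nonneg hμ.le (sub_nonneg.2 (hl y hy.1))) (exp_pos (μ * y)).le
    linarith
  have key2 : 1 + δ ≤ (h x + δ) * exp (μ * x) := by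
    refine image_le_of_deriv_right_le_deriv_boundary (a := 0) (b := x)
      (f := fun _ => 1 + δ) (f' := fun _ => 0) (B := fun t => (h t + δ) * exp (μ * t))
      (by fun_prop) (fun y _ => hasDerivWithinAt_const _ _ _) (by simp [h0])
      (by fun_prop) (fun y hy => ((hd y hy.1).add_const δ).mul (hexp y)) (fun y hy => ?_)
      ⟨hx, le_rfl⟩
    have := mul_nonneg (mul_nonneg hμ.le (sub_nonneg.2 (hu y hy.1))) (exp_pos (μ * y)).le
    linarith
  have hinv : exp (μ * x) * exp (-μ * x) = 1 := by rw [← exp_add]; simp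
  have hp := exp_pos (-μ * x)
  have e1 : h x ≤ exp (-μ * x) := by
    calc h x = h x * exp (μ * x) * exp (-μ * x) := by rw [mul_assoc, hinv, mul_one]
      _ ≤ 1 * exp (-μ * x) := by gcongr
      _ = _ := one_mul _
  have e2 : (1 + δ) * exp (-μ * x) ≤ h x + δ := by
    calc (1 + δ) * exp (-μ * x) ≤ (h x + δ) * exp (μ * x) * exp (-μ * x) := by gcongr
      _ = h x + δ := by rw [mul_assoc, hinv, mul_one]
  have := mul_nonneg hδ hp.le
  rw [abs_le]
  constructor <;> linarith [hl x hx, hu x hx]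

/-- A survival function `G` with mean `1 / μ` and
`0 ≤ G x * G y - G (x + y) ≤ δ * G y` is within `δ` of the exponential survival function. -/
lemma abs_sub_exp_le_of_mul_sub_le {μ δ : ℝ} (hμ : 0 < μ) {G : ℝ → ℝ}
    (hG : Antitone G) (hr : ∀ x, ContinuousWithinAt G (Ici x) x)
    (hmean : ∫ t in Ioi (0 : ℝ), G t = 1 / μ)
    (hnbu : ∀ x ≥ (0 : ℝ), ∀ y ≥ (0 : ℝ), G (x + y) ≤ G x * G y)
    (hδ : ∀ x ≥ (0 : ℝ), ∀ y ≥ (0 : ℝ), G x * G y - G (x + y) ≤ δ * G y)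
    {x : ℝ} (hx : 0 ≤ x) : |G x - exp (-μ * x)| ≤ δ := by
  have hloc (a b : ℝ) : IntervalIntegrable G volume a b := hG.intervalIntegrable
  have hintG : IntegrableOn G (Ioi 0) := by
    by_contra hn
    rw [integral_undef hn] at hmean
    exact (one_div_pos.2 hμ).ne hmean
  have hpre (x : ℝ) : (fun y => x + y) ⁻¹' Ioi x = Ioi 0 := by simp
  have hshift (x : ℝ) (hx : 0 ≤ x) : IntegrableOn (fun y => G (x + y)) (Ioi 0) := by
    have := ((measurePreserving_add_left volume x).integrableOn_comp_preimage
      (measurableEmbedding_addLeft x)).2 (hintG.mono_set (Ioi_subset_Ioi hx))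
    rwa [hpre] at this
  have htail (x : ℝ) (hx : 0 ≤ x) :
      ∫ y in Ioi (0 : ℝ), G (x + y) = 1 / μ - ∫ t in (0 : ℝ)..x, G t := by
    have := (measurePreserving_add_left volume x).setIntegral_preimage_emb
      (measurableEmbedding_addLeft x) G (Ioi x)
    rw [hpre] at this
    rw [this, ← hmean, ← intervalIntegral.integral_interval_add_Ioi hintG
      (hintG.mono_set (Ioi_subset_Ioi hx)), add_sub_cancel_left]
  have hGm (y : ℝ) : StronglyMeasurableAtFilter G (nhdsWithin y (Ioi y)) :=
    hG.measurable.stronglyMeasurable.stronglyMeasurableAtFilter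
  refine abs_sub_exp_le_of_hasDerivWithinAt hμ (h := fun x => 1 - μ * ∫ t in (0 : ℝ)..x, G t)
    ?_ (by simp) (fun y _ => ?_) (fun y hy => ?_) (fun y hy => ?_) hx
  · have := intervalIntegral.continuous_primitive hloc 0
    fun_prop
  · have := intervalIntegral.integral_hasDerivWithinAt_right (s := Ici y) (t := Ioi y)
      (hloc 0 y) (hGm y) ((hr y).mono Ioi_subset_Ici_self)
    exact (this.const_mul μ).const_sub 1
  · have := setIntegral_mono_on (hshift y hy) (hintG.const_mul (G y)) measurableSet_Ioi
      (fun t ht => hnbu y hy t (le_of_lt ht))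
    rw [htail y hy, integral_const_mul, hmean] at this
    field_simp at this
    linarith
  · have := setIntegral_mono_on ((hintG.const_mul (G y)).sub (hshift y hy)) (hintG.const_mul δ)
      measurableSet_Ioi (fun t ht => hδ y hy t (le_of_lt ht))
    simp only [Pi.sub_apply] at this
    rw [integral_sub (hintG.const_mul (G y)) (hshift y hy), htail y hy, integral_const_mul,
      integral_const_mul, hmean] at this
    field_simp at this
    linarith

/-- If `χ` is a nonnegative random variable (with law `ν`) with distribution function
`B`, mean `1/μ`, `B` is NBU, and `sup_{x≥0,y≥0} |B_y(x) - B(x)| < ε`, then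
`sup_{x≥0} |B(x) - (1 - e^{-μx})| < ε`. -/
theorem characterization_condition_C
    (μ ε : ℝ) (hμ : 0 < μ) (hε : 0 < ε)
    (ν : Measure ℝ) [IsProbabilityMeasure ν] (hν : ν (Set.Iio 0) = 0)
    (B : ℝ → ℝ) (hB : ∀ x, B x = (ν (Set.Iic x)).toReal)
    (hint : Integrable (fun x => x) ν)
    (hmean : ∫ x, x ∂ν = 1 / μ)
    (hNBU : IsNBU B)
    (hsup : sSup {d : ℝ | ∃ x ≥ (0:ℝ), ∃ y ≥ (0:ℝ), d = |condF B y x - B x|} < ε) :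
    sSup {d : ℝ | ∃ x ≥ (0:ℝ), d = |B x - (1 - Real.exp (-μ * x))|} < ε := by
  have hBcdf (x : ℝ) : B x = ProbabilityTheory.cdf ν x := by
    rw [hB, ProbabilityTheory.cdf_eq_real]; rfl
  have hmono : Monotone B := fun a b hab => by
    simpa only [hBcdf] using ProbabilityTheory.monotone_cdf ν hab
  have hB0 (x : ℝ) : 0 ≤ B x := hBcdf x ▸ ProbabilityTheory.cdf_nonneg ν x
  have hB1 (x : ℝ) : B x ≤ 1 := hBcdf x ▸ ProbabilityTheory.cdf_le_one ν x
  have hsurv (t : ℝ) : ν.real {a | t < a} = 1 - B t := by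
    rw [show {a : ℝ | t < a} = (Iic t)ᶜ by ext; simp, probReal_compl_eq_one_sub measurableSet_Iic,
      hB]
    rfl
  have hmeanG : ∫ t in Ioi (0 : ℝ), (1 - B t) = 1 / μ := by
    rw [← hmean, hint.integral_eq_integral_meas_lt]
    · simp only [hsurv]
    · rw [Filter.EventuallyLE, ae_iff]
      simpa [Iio, not_le] using hν
  set S := {d : ℝ | ∃ x ≥ (0:ℝ), ∃ y ≥ (0:ℝ), d = |condF B y x - B x|}
  have hbdd : BddAbove S := by
    refine ⟨1, ?_⟩
    rintro _ ⟨x, hx, y, hy, rfl⟩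
    have h1 : 0 ≤ condF B y x :=
      div_nonneg (sub_nonneg.2 (hmono (by linarith))) (sub_nonneg.2 (hB1 y))
    have h2 : condF B y x ≤ 1 :=
      div_le_one_of_le₀ (by linarith [hB1 (x + y)]) (sub_nonneg.2 (hB1 y))
    rw [abs_le]
    constructor <;> linarith [hB0 x, hB1 x]
  refine lt_of_le_of_lt (csSup_le ⟨_, 0, le_rfl, rfl⟩ ?_) hsup
  rintro _ ⟨x, hx, rfl⟩
  have hr (x : ℝ) : ContinuousWithinAt (fun t => 1 - B t) (Ici x) x := by
    simp only [hBcdf]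
    exact continuousWithinAt_const.sub ((ProbabilityTheory.cdf ν).right_continuous x)
  have main := abs_sub_exp_le_of_mul_sub_le (G := fun t => 1 - B t) (δ := sSup S) hμ
    (fun a b hab => sub_le_sub_left (hmono hab) 1) hr hmeanG hNBU (fun x hx y hy => ?_) hx
  · rw [abs_le] at main ⊢
    constructor <;> linarith [main.1, main.2]
  · have hle : |condF B y x - B x| ≤ sSup S := le_csSup hbdd ⟨x, hx, y, hy, rfl⟩
    rcases (hB1 y).eq_or_lt with h | h
    · have : B (x + y) = 1 := le_antisymm (hB1 _) (h ▸ hmono (by linarith))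
      simp [h, this]
    · have hpos : 0 < 1 - B y := sub_pos.2 h
      calc (1 - B x) * (1 - B y) - (1 - B (x + y)) = (condF B y x - B x) * (1 - B y) := by
            rw [condF, sub_mul (_ / _), div_mul_cancel₀ _ hpos.ne']; ring
        _ ≤ sSup S * (1 - B y) := by
            gcongr
            exact (le_abs_self _).trans hle
end
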